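/- arXiv:2302.12608 — 8 statements merged into one kernel-verified Lean document; each statement's English description precedes it below -/
import Mathlib

section
/- Let m ≥ 1, n ≥ 1, μ ≠ 0 be a real constant, and f : ℝⁿ → ℝ. Suppose v : ℝᵐ × ℝ → ℝ is smooth and solves the canonical multitime reaction-diffusion equation ∑_{i=1}^m ∂v/∂τⁱ = μ ∂ⁿv/∂xⁿ + f(v, ∂v/∂x, …, ∂^{n−1}v/∂x^{n−1}). Suppose for each i the function hⁱ : ℝ → ℝ is continuous and nonvanishing on an open interval Jⁱ, and Tⁱ : Jⁱ → ℝ is differentiable with (Tⁱ)'(s) = 1/hⁱ(s) for all s ∈ Jⁱ. Then the function u(t¹,…,tᵐ,x) := v(T¹(t¹),…,Tᵐ(tᵐ),x) satisfies the multitime reaction-diffusion equation h¹(t¹) ∂u/∂t¹ + … + hᵐ(tᵐ) ∂u/∂tᵐ = μ ∂ⁿu/∂xⁿ + f(u, ∂u/∂x, …, ∂^{n−1}u/∂x^{n−1}) on J¹ × … × Jᵐ × ℝ. -/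
/-- The chain rule for a reparametrization `tⁱ ↦ Tⁱ(tⁱ)` of each time variable separately. -/
theorem fderiv_comp_separate_single {m : ℕ} {v : (Fin m → ℝ) × ℝ → ℝ} {T : Fin m → ℝ → ℝ}
    {T' : Fin m → ℝ} {t : Fin m → ℝ} {x : ℝ}
    (hv : DifferentiableAt ℝ v (fun i => T i (t i), x))
    (hT : ∀ i, HasDerivAt (T i) (T' i) (t i)) (i : Fin m) :
    fderiv ℝ (fun p : (Fin m → ℝ) × ℝ => v (fun j => T j (p.1 j), p.2)) (t, x)
        (Pi.single i 1, 0) =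
      T' i * fderiv ℝ v (fun j => T j (t j), x) (Pi.single i 1, 0) := by
  have hcoord : ∀ j, HasFDerivAt (fun p : (Fin m → ℝ) × ℝ => T j (p.1 j))
      (T' j • (ContinuousLinearMap.proj (R := ℝ) (φ := fun _ : Fin m => ℝ) j).comp
        (ContinuousLinearMap.fst ℝ (Fin m → ℝ) ℝ)) (t, x) := fun j =>
    (hT j).comp_hasFDerivAt (t, x)
      ((ContinuousLinearMap.proj (R := ℝ) (φ := fun _ : Fin m => ℝ) j).comp
        (ContinuousLinearMap.fst ℝ (Fin m → ℝ) ℝ)).hasFDerivAt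
  have hmap := (hasFDerivAt_pi.2 hcoord).prodMk
    (hasFDerivAt_snd (𝕜 := ℝ) (p := ((t, x) : (Fin m → ℝ) × ℝ)))
  have hcomp := HasFDerivAt.comp (t, x) hv.hasFDerivAt hmap
  have hvec : ((fun j => T' j * (Pi.single i 1 : Fin m → ℝ) j, 0) : (Fin m → ℝ) × ℝ) =
      T' i • (Pi.single i 1, 0) := by
    ext j
    · rcases eq_or_ne j i with rfl | hj <;> simp [*]
    · simp
  refine (congrArg (fun L => L (Pi.single i 1, 0)) hcomp.fderiv).trans ?_
  rw [← smul_eq_mul, ← map_smul, ← hvec]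
  rfl

/-- changing the time variables `tⁱ ↦ Tⁱ(tⁱ)` (with `(Tⁱ)' = 1/hⁱ` on the
open interval `Jⁱ`, where `hⁱ` is continuous and nonvanishing) transforms a solution `v`
of the canonical multitime reaction-diffusion equation into a solution `u` of the
multitime reaction-diffusion equation with coefficients `hⁱ(tⁱ)`. -/
theorem stmt_0 (m n : ℕ) (hm : 1 ≤ m) (hn : 1 ≤ n) (μ : ℝ) (hμ : μ ≠ 0)
    (f : (Fin n → ℝ) → ℝ)
    (v : (Fin m → ℝ) × ℝ → ℝ) (hv : ContDiff ℝ (⊤ : ℕ∞) v)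
    (hveq : ∀ (τ : Fin m → ℝ) (x : ℝ),
      ∑ i : Fin m, fderiv ℝ v (τ, x) (Pi.single i 1, 0) =
        μ * deriv^[n] (fun y => v (τ, y)) x +
          f (fun j => deriv^[(j : ℕ)] (fun y => v (τ, y)) x))
    (h T : Fin m → ℝ → ℝ) (J : Fin m → Set ℝ)
    (hJ : ∀ i, ∃ a b : ℝ, J i = Set.Ioo a b)
    (hcont : ∀ i, ContinuousOn (h i) (J i))
    (hne : ∀ i, ∀ s ∈ J i, h i s ≠ 0)
    (hT : ∀ i, ∀ s ∈ J i, HasDerivAt (T i) (1 / h i s) s)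
    (u : (Fin m → ℝ) × ℝ → ℝ)
    (hu : ∀ (t : Fin m → ℝ) (x : ℝ), u (t, x) = v (fun i => T i (t i), x)) :
    ∀ (t : Fin m → ℝ), (∀ i, t i ∈ J i) → ∀ x : ℝ,
      ∑ i : Fin m, h i (t i) * fderiv ℝ u (t, x) (Pi.single i 1, 0) =
        μ * deriv^[n] (fun y => u (t, y)) x +
          f (fun j => deriv^[(j : ℕ)] (fun y => u (t, y)) x) := by
  intro t ht x
  obtain rfl : u = fun p => v (fun i => T i (p.1 i), p.2) := funext fun p => hu p.1 p.2
  refine Eq.trans ?_ (hveq (fun i => T i (t i)) x)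
  refine Finset.sum_congr rfl fun i _ => ?_
  rw [fderiv_comp_separate_single (hv.differentiable (by simp) _) fun j => hT j _ (ht j),
    ← mul_assoc, mul_one_div_cancel (hne i _ (ht i)), one_mul]
end

section
/- Let m ≥ 1, n ≥ 1, μ ≠ 0 and k be real constants, and f : ℝⁿ → ℝ. Let φ : ℝᵐ × ℝ → ℝ be smooth and solve the drift equation ∑_{i=1}^m ∂φ/∂τⁱ = μ ∂ⁿφ/∂xⁿ − k ∂φ/∂x + f(φ, ∂φ/∂x, …, ∂^{n−1}φ/∂x^{n−1}). Let v : ℝᵐ → ℝ be differentiable with ∑_{i=1}^m ∂v/∂τⁱ = 1, and let P : ℝᵐ → ℝ be differentiable with ∑_{i=1}^m ∂P/∂τⁱ = 0. Then u(τ, x) := φ(τ, x + k v(τ) + P(τ)) solves the canonical multitime reaction-diffusion equation ∑_{i=1}^m ∂u/∂τⁱ = μ ∂ⁿu/∂xⁿ + f(u, ∂u/∂x, …, ∂^{n−1}u/∂x^{n−1}). -/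
theorem deriv_iterate_comp_add_const (g : ℝ → ℝ) (c : ℝ) (j : ℕ) (x : ℝ) :
    deriv^[j] (fun y => g (y + c)) x = deriv^[j] g (x + c) := by
  rw [← iteratedDeriv_eq_iterate, ← iteratedDeriv_eq_iterate, iteratedDeriv_comp_add_const]

/-- Chain rule for a spatial shift depending on the first variable. -/
theorem fderiv_comp_add_shift {E : Type*} [NormedAddCommGroup E] [NormedSpace ℝ E]
    {φ : E × ℝ → ℝ} (hφ : Differentiable ℝ φ) {s : E → ℝ} (hs : Differentiable ℝ s)
    (τ : E) (x : ℝ) (e : E) :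
    fderiv ℝ (fun p : E × ℝ => φ (p.1, p.2 + s p.1)) (τ, x) (e, 0) =
      fderiv ℝ φ (τ, x + s τ) (e, 0) +
        fderiv ℝ s τ e * deriv (fun y => φ (τ, y)) (x + s τ) := by
  have hderiv : HasDerivAt (fun y => φ (τ, y)) (fderiv ℝ φ (τ, x + s τ) (0, 1)) (x + s τ) :=
    (hφ (τ, x + s τ)).hasFDerivAt.comp_hasDerivAt (x + s τ)
      ((hasDerivAt_const _ τ).prodMk (hasDerivAt_id _))
  have hshift : HasFDerivAt (fun p : E × ℝ => (p.1, p.2 + s p.1))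
      ((ContinuousLinearMap.fst ℝ E ℝ).prod
        (ContinuousLinearMap.snd ℝ E ℝ + (fderiv ℝ s τ).comp (ContinuousLinearMap.fst ℝ E ℝ)))
      (τ, x) :=
    hasFDerivAt_fst.prodMk
      (hasFDerivAt_snd.add ((hs τ).hasFDerivAt.comp (τ, x) hasFDerivAt_fst))
  have hcomp : HasFDerivAt (fun p : E × ℝ => φ (p.1, p.2 + s p.1)) _ (τ, x) :=
    (hφ (τ, x + s τ)).hasFDerivAt.comp (τ, x) hshift
  have hsplit : (e, fderiv ℝ s τ e) = (e, (0 : ℝ)) + fderiv ℝ s τ e • ((0 : E), (1 : ℝ)) := by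
    simp
  rw [hcomp.fderiv, hderiv.deriv, ← smul_eq_mul, ← map_smul, ← map_add, ← hsplit]
  simp


/-- if `φ` solves the drift equation, `v` solves `∑ᵢ ∂v/∂τⁱ = 1` and
`P` solves `∑ᵢ ∂P/∂τⁱ = 0`, then `u(τ,x) := φ(τ, x + k v(τ) + P(τ))` solves the
canonical multitime reaction-diffusion equation. -/
theorem stmt_1 (m n : ℕ) (hm : 1 ≤ m) (hn : 1 ≤ n) (μ k : ℝ) (hμ : μ ≠ 0)
    (f : (Fin n → ℝ) → ℝ)
    (φ : (Fin m → ℝ) × ℝ → ℝ) (hφ : ContDiff ℝ (⊤ : ℕ∞) φ)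
    (hφeq : ∀ (τ : Fin m → ℝ) (x : ℝ),
      ∑ i : Fin m, fderiv ℝ φ (τ, x) (Pi.single i 1, 0) =
        μ * deriv^[n] (fun y => φ (τ, y)) x - k * deriv (fun y => φ (τ, y)) x +
          f (fun j => deriv^[(j : ℕ)] (fun y => φ (τ, y)) x))
    (v : (Fin m → ℝ) → ℝ) (hv : Differentiable ℝ v)
    (hveq : ∀ τ : Fin m → ℝ, ∑ i : Fin m, fderiv ℝ v τ (Pi.single i 1) = 1)
    (P : (Fin m → ℝ) → ℝ) (hP : Differentiable ℝ P)
    (hPeq : ∀ τ : Fin m → ℝ, ∑ i : Fin m, fderiv ℝ P τ (Pi.single i 1) = 0)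
    (u : (Fin m → ℝ) × ℝ → ℝ)
    (hu : ∀ (τ : Fin m → ℝ) (x : ℝ), u (τ, x) = φ (τ, x + k * v τ + P τ)) :
    ∀ (τ : Fin m → ℝ) (x : ℝ),
      ∑ i : Fin m, fderiv ℝ u (τ, x) (Pi.single i 1, 0) =
        μ * deriv^[n] (fun y => u (τ, y)) x +
          f (fun j => deriv^[(j : ℕ)] (fun y => u (τ, y)) x) := by
  intro τ x
  have hs : Differentiable ℝ (fun σ => k * v σ + P σ) := (hv.const_mul k).add hP
  have hsum : ∑ i : Fin m, fderiv ℝ (fun σ => k * v σ + P σ) τ (Pi.single i 1) = k := by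
    have hfd : fderiv ℝ (fun σ => k * v σ + P σ) τ = k • fderiv ℝ v τ + fderiv ℝ P τ :=
      (((hv τ).hasFDerivAt.const_mul k).add (hP τ).hasFDerivAt).fderiv
    simp [hfd, Finset.sum_add_distrib, ← Finset.mul_sum, hveq, hPeq]
  have hu' : u = fun p => φ (p.1, p.2 + (k * v p.1 + P p.1)) := by
    ext ⟨σ, y⟩
    rw [hu, add_assoc]
  have hφd : Differentiable ℝ φ := hφ.differentiable (by simp)
  subst hu'
  simp only [fderiv_comp_add_shift hφd hs, Finset.sum_add_distrib, ← Finset.sum_mul, hsum, hφeq,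
    deriv_iterate_comp_add_const (fun y => φ (τ, y))]
  ring
end

section
/- Let m ≥ 1, n ≥ 1, μ ≠ 0 and k be real constants, and f : ℝⁿ → ℝ. Let φ : ℝᵐ × ℝ → ℝ be smooth, let v : ℝᵐ → ℝ be differentiable with ∑_{i=1}^m ∂v/∂τⁱ = 1, and let P : ℝᵐ → ℝ be differentiable with ∑_{i=1}^m ∂P/∂τⁱ = 0. If the function u(τ, x) := φ(τ, x + k v(τ) + P(τ)) solves the canonical multitime reaction-diffusion equation ∑_{i=1}^m ∂u/∂τⁱ = μ ∂ⁿu/∂xⁿ + f(u, ∂u/∂x, …, ∂^{n−1}u/∂x^{n−1}) at every point of ℝᵐ × ℝ, then φ solves the drift equation ∑_{i=1}^m ∂φ/∂τⁱ = μ ∂ⁿφ/∂xⁿ − k ∂φ/∂x + f(φ, ∂φ/∂x, …, ∂^{n−1}φ/∂x^{n−1}) at every point of ℝᵐ × ℝ. -/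
/-- A partial derivative along the first factor of `p ↦ φ (p.1, p.2 + w p.1)`. -/
theorem fderiv_comp_shear_apply {E F : Type*} [NormedAddCommGroup E] [NormedSpace ℝ E]
    [NormedAddCommGroup F] [NormedSpace ℝ F] {φ : E × ℝ → F} {w : E → ℝ} {τ : E} {x : ℝ}
    (hφ : DifferentiableAt ℝ φ (τ, x + w τ)) (hw : DifferentiableAt ℝ w τ) (e : E) :
    fderiv ℝ (fun p : E × ℝ => φ (p.1, p.2 + w p.1)) (τ, x) (e, 0) =
      fderiv ℝ φ (τ, x + w τ) (e, 0) +
        fderiv ℝ w τ e • deriv (fun y => φ (τ, y)) (x + w τ) := by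
  have hT : HasFDerivAt (fun p : E × ℝ => (p.1, p.2 + w p.1))
      ((ContinuousLinearMap.fst ℝ E ℝ).prod (ContinuousLinearMap.snd ℝ E ℝ +
        (fderiv ℝ w τ).comp (ContinuousLinearMap.fst ℝ E ℝ))) (τ, x) :=
    hasFDerivAt_fst.prodMk (hasFDerivAt_snd.add
      (HasFDerivAt.comp (g := w) (τ, x) hw.hasFDerivAt hasFDerivAt_fst))
  have hslice : deriv (fun y => φ (τ, y)) (x + w τ) = fderiv ℝ φ (τ, x + w τ) (0, 1) :=
    (hφ.hasFDerivAt.comp_hasDerivAt (x + w τ)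
      ((hasDerivAt_const _ τ).prodMk (hasDerivAt_id _))).deriv
  have hcomp := HasFDerivAt.comp (g := φ) (τ, x) hφ.hasFDerivAt hT
  have hsplit : (e, fderiv ℝ w τ e) = (e, (0 : ℝ)) + fderiv ℝ w τ e • ((0 : E), (1 : ℝ)) := by
    simp
  rw [hslice, ← map_smul, ← map_add, ← hsplit]
  exact (congrArg (fun L : E × ℝ →L[ℝ] F => L (e, 0)) hcomp.fderiv).trans (by simp)


/-- converse of Statement 1: if `u(τ,x) := φ(τ, x + k v(τ) + P(τ))`
solves the canonical multitime reaction-diffusion equation everywhere, then `φ`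
solves the drift equation everywhere. -/
theorem stmt_2 (m n : ℕ) (hm : 1 ≤ m) (hn : 1 ≤ n) (μ k : ℝ) (hμ : μ ≠ 0)
    (f : (Fin n → ℝ) → ℝ)
    (φ : (Fin m → ℝ) × ℝ → ℝ) (hφ : ContDiff ℝ (⊤ : ℕ∞) φ)
    (v : (Fin m → ℝ) → ℝ) (hv : Differentiable ℝ v)
    (hveq : ∀ τ : Fin m → ℝ, ∑ i : Fin m, fderiv ℝ v τ (Pi.single i 1) = 1)
    (P : (Fin m → ℝ) → ℝ) (hP : Differentiable ℝ P)
    (hPeq : ∀ τ : Fin m → ℝ, ∑ i : Fin m, fderiv ℝ P τ (Pi.single i 1) = 0)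
    (u : (Fin m → ℝ) × ℝ → ℝ)
    (hu : ∀ (τ : Fin m → ℝ) (x : ℝ), u (τ, x) = φ (τ, x + k * v τ + P τ))
    (hueq : ∀ (τ : Fin m → ℝ) (x : ℝ),
      ∑ i : Fin m, fderiv ℝ u (τ, x) (Pi.single i 1, 0) =
        μ * deriv^[n] (fun y => u (τ, y)) x +
          f (fun j => deriv^[(j : ℕ)] (fun y => u (τ, y)) x)) :
    ∀ (τ : Fin m → ℝ) (x : ℝ),
      ∑ i : Fin m, fderiv ℝ φ (τ, x) (Pi.single i 1, 0) =
        μ * deriv^[n] (fun y => φ (τ, y)) x - k * deriv (fun y => φ (τ, y)) x +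
          f (fun j => deriv^[(j : ℕ)] (fun y => φ (τ, y)) x) := by
  intro τ x
  have hw : Differentiable ℝ fun σ => k * v σ + P σ := (hv.const_mul k).add hP
  have hu' : u = fun p => φ (p.1, p.2 + (k * v p.1 + P p.1)) := by
    funext p
    rw [← add_assoc]
    exact hu p.1 p.2
  have hwsum : ∑ i : Fin m, fderiv ℝ (fun σ => k * v σ + P σ) τ (Pi.single i 1) = k := by
    have hfd : fderiv ℝ (fun σ => k * v σ + P σ) τ = k • fderiv ℝ v τ + fderiv ℝ P τ :=
      (((hv τ).hasFDerivAt.const_mul k).add (hP τ).hasFDerivAt).fderiv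
    simp [hfd, Finset.sum_add_distrib, ← Finset.mul_sum, hveq, hPeq]
  have hshift : ∀ (j : ℕ) (y : ℝ), deriv^[j] (fun z => u (τ, z)) y =
      deriv^[j] (fun z => φ (τ, z)) (y + (k * v τ + P τ)) := by
    intro j y
    simp only [← iteratedDeriv_eq_iterate, hu']
    exact congrFun (iteratedDeriv_comp_add_const j (fun z => φ (τ, z)) (k * v τ + P τ)) y
  have hdφ : Differentiable ℝ φ := hφ.differentiable (by simp)
  have key := hueq τ (x - (k * v τ + P τ))
  simp only [hshift] at key
  simp only [hu', fderiv_comp_shear_apply (w := fun σ => k * v σ + P σ) (hdφ _) (hw τ),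
    Finset.sum_add_distrib, smul_eq_mul, ← Finset.sum_mul, hwsum, sub_add_cancel] at key
  linarith
end

section
/- Let m ≥ 2, n ≥ 1, μ ≠ 0 and k be real constants, and f : ℝⁿ → ℝ. Let ψ : ℝ^{m−1} × ℝ → ℝ be a smooth function such that for every fixed ω ∈ ℝ^{m−1} the function y ↦ ψ(ω, y) solves the ordinary differential equation μ ψ^{(n)}(y) − k ψ'(y) + f(ψ(y), ψ'(y), …, ψ^{(n−1)}(y)) = 0 for all y ∈ ℝ. Then the function u(τ, x) := ψ(τᵐ − τ¹, …, τᵐ − τ^{m−1}, x + k τᵐ) solves the canonical multitime reaction-diffusion equation ∑_{i=1}^m ∂u/∂τⁱ = μ ∂ⁿu/∂xⁿ + f(u, ∂u/∂x, …, ∂^{n−1}u/∂x^{n−1}) at every point of ℝᵐ × ℝ. -/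
/-- The sum of the partial derivatives in the first factor is the derivative along the
diagonal. -/
theorem sum_fderiv_single_eq {m : ℕ} (u : (Fin m → ℝ) × ℝ → ℝ) (p : (Fin m → ℝ) × ℝ) :
    ∑ i : Fin m, fderiv ℝ u p (Pi.single i 1, 0) = fderiv ℝ u p (fun _ => 1, 0) := by
  rw [← map_sum]
  congr 1
  ext j
  · simp [Prod.fst_sum, Finset.sum_apply, Pi.single_apply]
  · simp [Prod.snd_sum]

/-- if for each fixed `ω ∈ ℝ^{m−1}` the function `y ↦ ψ(ω,y)` solves the
ODE `μ ψ⁽ⁿ⁾ − k ψ' + f(ψ, ψ', …, ψ^{(n−1)}) = 0`, then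
`u(τ,x) := ψ(τᵐ − τ¹, …, τᵐ − τ^{m−1}, x + k τᵐ)` solves the canonical multitime
reaction-diffusion equation. -/
theorem stmt_6 (m n : ℕ) (hm : 2 ≤ m) (hn : 1 ≤ n) (μ k : ℝ) (hμ : μ ≠ 0)
    (f : (Fin n → ℝ) → ℝ)
    (ψ : (Fin (m - 1) → ℝ) × ℝ → ℝ) (hψ : ContDiff ℝ (⊤ : ℕ∞) ψ)
    (hψode : ∀ (ω : Fin (m - 1) → ℝ) (y : ℝ),
      μ * deriv^[n] (fun z => ψ (ω, z)) y - k * deriv (fun z => ψ (ω, z)) y +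
        f (fun j => deriv^[(j : ℕ)] (fun z => ψ (ω, z)) y) = 0)
    (u : (Fin m → ℝ) × ℝ → ℝ)
    (hu : ∀ (τ : Fin m → ℝ) (x : ℝ),
      u (τ, x) = ψ ((fun j => τ ⟨m - 1, by omega⟩ - τ (Fin.castLE (by omega) j)),
        x + k * τ ⟨m - 1, by omega⟩)) :
    ∀ (τ : Fin m → ℝ) (x : ℝ),
      ∑ i : Fin m, fderiv ℝ u (τ, x) (Pi.single i 1, 0) =
        μ * deriv^[n] (fun y => u (τ, y)) x +
          f (fun j => deriv^[(j : ℕ)] (fun y => u (τ, y)) x) := by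
  intro τ x
  set l : Fin m := ⟨m - 1, by omega⟩
  have hcast : m - 1 ≤ m := by omega
  set ω : Fin (m - 1) → ℝ := fun j => τ l - τ (Fin.castLE hcast j) with hω
  set g : ℝ → ℝ := fun z => ψ (ω, z) with hg
  have hψd : Differentiable ℝ ψ := hψ.differentiable (by simp)
  have hgd : Differentiable ℝ g := hψd.comp (by fun_prop)
  have hud : Differentiable ℝ u := by
    have huf : u = fun p => ψ ((fun j => p.1 l - p.1 (Fin.castLE hcast j)), p.2 + k * p.1 l) :=
      funext fun p => hu p.1 p.2
    rw [huf]
    exact hψd.comp (by fun_prop)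
  have hslice : (fun y => u (τ, y)) = fun y => g (y + k * τ l) := funext fun y => hu τ y
  have hdiag : fderiv ℝ u (τ, x) (fun _ => 1, 0) = k * deriv g (x + k * τ l) := by
    rw [← (hud (τ, x)).lineDeriv_eq_fderiv, lineDeriv]
    have hline : (fun t : ℝ => u ((τ, x) + t • ((fun _ => 1 : Fin m → ℝ), (0 : ℝ)))) =
        fun t => g (x + k * τ l + k * t) := by
      funext t
      have hp : (τ, x) + t • ((fun _ => 1 : Fin m → ℝ), (0 : ℝ)) = (fun i => τ i + t, x) := by
        ext <;> simp
      rw [hp, hu]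
      simp only [hg, hω, add_sub_add_right_eq_sub, mul_add, add_assoc]
    rw [hline]
    have h1 : HasDerivAt (fun t : ℝ => x + k * τ l + k * t) k 0 := by
      simpa using ((hasDerivAt_id (0 : ℝ)).const_mul k).const_add (x + k * τ l)
    have h2 : HasDerivAt g (deriv g (x + k * τ l)) (x + k * τ l + k * 0) := by
      simpa using (hgd (x + k * τ l)).hasDerivAt
    exact (h2.comp 0 h1).deriv.trans (mul_comm _ _)
  rw [sum_fderiv_single_eq, hdiag, hslice]
  simp only [deriv_iterate_comp_add_const]
  linarith [hψode ω (x + k * τ l)]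
end

section
/- Let m ≥ 2 and let P : ℝ^{m−1} → ℝ be differentiable. Let D(τ, x) := x − √2 τᵐ + P(τᵐ − τ¹, …, τᵐ − τ^{m−1}). Then on the open set where D(τ, x) ≠ 0, the function u(τ, x) := √2 / D(τ, x) solves the normalized multitime Huxley equation ∑_{i=1}^m ∂u/∂τⁱ = ∂²u/∂x² − u³ + u². -/
/-- The second derivative of a simple pole. -/
theorem iterate_two_deriv_const_div_add (a c x : ℝ) (hx : x + c ≠ 0) :
    deriv^[2] (fun y => a / (y + c)) x = 2 * a / (x + c) ^ 3 := by
  have h1 : deriv (fun y : ℝ => a / (y + c)) =ᶠ[nhds x] fun y => -a / (y + c) ^ 2 := by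
    have hne : ∀ᶠ y in nhds x, y + c ≠ 0 :=
      ContinuousAt.eventually_ne (by fun_prop) hx
    filter_upwards [hne] with y hy
    have h := (hasDerivAt_const y a).fun_div ((hasDerivAt_id' y).add_const c) hy
    rw [h.deriv]
    ring
  have h2 := (hasDerivAt_const x (-a)).fun_div
    (((hasDerivAt_id' x).add_const c).fun_pow 2) (pow_ne_zero 2 hx)
  simp only [Function.iterate_succ, Function.iterate_zero, Function.comp_apply, id]
  rw [h1.deriv_eq, h2.deriv]
  field_simp
  ring

/-- Summing the partial derivatives in the first variable gives the derivative along the diagonal. -/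
theorem sum_apply_single_one_zero {ι : Type*} [Fintype ι] [DecidableEq ι]
    (L : (ι → ℝ) × ℝ →L[ℝ] ℝ) :
    ∑ i, L (Pi.single i 1, 0) = L (1, 0) := by
  rw [← map_sum]
  congr 1
  ext j
  · simp [Prod.fst_sum, Finset.sum_apply, Pi.single_apply]
  · simp [Prod.snd_sum]

/-- `u(τ,x) := √2 / (x − √2 τᵐ + P(τᵐ − τ¹, …, τᵐ − τ^{m−1}))` solves the
normalized multitime Huxley equation wherever the denominator does not vanish. -/
theorem stmt_11 (m : ℕ) (hm : 2 ≤ m)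
    (P : (Fin (m - 1) → ℝ) → ℝ) (hP : Differentiable ℝ P)
    (D : (Fin m → ℝ) × ℝ → ℝ)
    (hD : ∀ (τ : Fin m → ℝ) (x : ℝ),
      D (τ, x) = x - Real.sqrt 2 * τ ⟨m - 1, by omega⟩ +
        P (fun j => τ ⟨m - 1, by omega⟩ - τ (Fin.castLE (by omega) j)))
    (u : (Fin m → ℝ) × ℝ → ℝ)
    (hu : ∀ (τ : Fin m → ℝ) (x : ℝ), u (τ, x) = Real.sqrt 2 / D (τ, x)) :
    ∀ (τ : Fin m → ℝ) (x : ℝ), D (τ, x) ≠ 0 →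
      ∑ i : Fin m, fderiv ℝ u (τ, x) (Pi.single i 1, 0) =
        deriv^[2] (fun y => u (τ, y)) x - (u (τ, x)) ^ 3 + (u (τ, x)) ^ 2 := by
  intro τ x hx
  have hD' : D = fun p => p.2 - Real.sqrt 2 * p.1 ⟨m - 1, by omega⟩ +
      P (fun j => p.1 ⟨m - 1, by omega⟩ - p.1 (Fin.castLE (by omega) j)) :=
    funext fun p => hD p.1 p.2
  have hu' : u = fun p => Real.sqrt 2 / D p := funext fun p => hu p.1 p.2
  have hDd : Differentiable ℝ D := by
    rw [hD']
    fun_prop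
  have hud : DifferentiableAt ℝ u (τ, x) := by
    simp only [hu', div_eq_mul_inv]
    exact ((hDd _).fun_inv hx).const_mul _
  have hs : Real.sqrt 2 ^ 2 = 2 := Real.sq_sqrt (by norm_num)
  -- Along the diagonal the argument of `P` is constant.
  have hdiag : ∀ t : ℝ, u ((τ, x) + t • ((1 : Fin m → ℝ), (0 : ℝ))) =
      Real.sqrt 2 / (D (τ, x) - Real.sqrt 2 * t) := by
    intro t
    rw [hu', hD']
    simp
    ring_nf
  have ht : fderiv ℝ u (τ, x) (1, 0) = 2 / D (τ, x) ^ 2 := by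
    rw [← hud.lineDeriv_eq_fderiv, lineDeriv, funext hdiag]
    have h := (hasDerivAt_const (0 : ℝ) (Real.sqrt 2)).fun_div
      (((hasDerivAt_id' (0 : ℝ)).const_mul (Real.sqrt 2)).const_sub (D (τ, x))) (by simpa using hx)
    rw [h.deriv]
    simp [← pow_two]
  have hxx : deriv^[2] (fun y => u (τ, y)) x = 2 * Real.sqrt 2 / D (τ, x) ^ 3 := by
    have hy : ∀ y, D (τ, y) = y + (D (τ, x) - x) := by
      intro y
      rw [hD, hD]
      ring
    have hf : (fun y => u (τ, y)) = fun y => Real.sqrt 2 / (y + (D (τ, x) - x)) :=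
      funext fun y => by rw [hu, hy y]
    rw [hf, iterate_two_deriv_const_div_add _ _ _ (by simpa using hx), add_sub_cancel]
  rw [sum_apply_single_one_zero, ht, hxx, hu, div_pow, div_pow, pow_succ (Real.sqrt 2) 2, hs]
  ring
end

section
/- Let m ≥ 2 and let P : ℝ^{m−1} → ℝ be differentiable. Let E(τ,x) := 1 + P(τᵐ − τ¹, …, τᵐ − τ^{m−1}) · exp(x/√2 − τᵐ/2). Then on the open set where E(τ, x) ≠ 0, the function u(τ, x) := 1 / E(τ, x) solves the normalized multitime Huxley equation ∑_{i=1}^m ∂u/∂τⁱ = ∂²u/∂x² − u³ + u². -/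
/-- First derivative of `s ↦ 1 / (1 + p * exp (a * s + b))`. -/
theorem hasDerivAt_one_div_one_add_mul_exp (p a b s : ℝ)
    (h : 1 + p * Real.exp (a * s + b) ≠ 0) :
    HasDerivAt (fun s => 1 / (1 + p * Real.exp (a * s + b)))
      (-(a * (p * Real.exp (a * s + b))) / (1 + p * Real.exp (a * s + b)) ^ 2) s := by
  have h1 : HasDerivAt (fun s : ℝ => a * s + b) a s := by
    simpa using ((hasDerivAt_id s).const_mul a).add_const b
  have h2 := ((h1.exp.const_mul p).const_add 1).fun_inv h
  simp only [one_div]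
  exact h2.congr_deriv (by ring)

/-- Second derivative of `s ↦ 1 / (1 + p * exp (a * s + b))`. -/
theorem iterate_two_deriv_one_div_one_add_mul_exp (p a b s : ℝ)
    (h : 1 + p * Real.exp (a * s + b) ≠ 0) :
    deriv^[2] (fun s => 1 / (1 + p * Real.exp (a * s + b))) s =
      a ^ 2 * (p * Real.exp (a * s + b)) * (p * Real.exp (a * s + b) - 1) /
        (1 + p * Real.exp (a * s + b)) ^ 3 := by
  have hc : Continuous fun s : ℝ => 1 + p * Real.exp (a * s + b) := by fun_prop
  have hd : deriv (fun s => 1 / (1 + p * Real.exp (a * s + b))) =ᶠ[nhds s] fun s =>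
      -(a * (p * Real.exp (a * s + b))) / (1 + p * Real.exp (a * s + b)) ^ 2 := by
    filter_upwards [hc.continuousAt.eventually_ne h] with y hy
    exact (hasDerivAt_one_div_one_add_mul_exp p a b y hy).deriv
  simp only [Function.iterate_succ, Function.iterate_zero, Function.comp_apply, id]
  rw [hd.deriv_eq]
  have h1 : HasDerivAt (fun s : ℝ => a * s + b) a s := by
    simpa using ((hasDerivAt_id s).const_mul a).add_const b
  have h2 := h1.exp.const_mul p
  have h3 := (h2.const_mul a).fun_neg.fun_div ((h2.const_add 1).fun_pow 2) (pow_ne_zero 2 h)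
  rw [h3.deriv]
  field_simp
  push_cast
  ring

/-- `u(τ,x) := 1 / (1 + P(τᵐ − τ¹, …, τᵐ − τ^{m−1}) · exp(x/√2 − τᵐ/2))`
solves the normalized multitime Huxley equation wherever the denominator does not
vanish. -/
theorem stmt_12 (m : ℕ) (hm : 2 ≤ m)
    (P : (Fin (m - 1) → ℝ) → ℝ) (hP : Differentiable ℝ P)
    (E : (Fin m → ℝ) × ℝ → ℝ)
    (hE : ∀ (τ : Fin m → ℝ) (x : ℝ),
      E (τ, x) = 1 + P (fun j => τ ⟨m - 1, by omega⟩ - τ (Fin.castLE (by omega) j)) *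
        Real.exp (x / Real.sqrt 2 - τ ⟨m - 1, by omega⟩ / 2))
    (u : (Fin m → ℝ) × ℝ → ℝ)
    (hu : ∀ (τ : Fin m → ℝ) (x : ℝ), u (τ, x) = 1 / E (τ, x)) :
    ∀ (τ : Fin m → ℝ) (x : ℝ), E (τ, x) ≠ 0 →
      ∑ i : Fin m, fderiv ℝ u (τ, x) (Pi.single i 1, 0) =
        deriv^[2] (fun y => u (τ, y)) x - (u (τ, x)) ^ 3 + (u (τ, x)) ^ 2 := by
  intro τ x hE0
  have hw := hE τ x
  set l : Fin m := ⟨m - 1, by omega⟩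
  set p := P (fun j => τ l - τ (Fin.castLE (by omega) j)) with hp
  have hdiff : DifferentiableAt ℝ u (τ, x) := by
    have hu' : u = fun z => (E z)⁻¹ := by
      funext ⟨σ, y⟩
      rw [hu, one_div]
    have hE' : E = fun z => 1 + P (fun j => z.1 l - z.1 (Fin.castLE (by omega) j)) *
        Real.exp (z.2 / Real.sqrt 2 - z.1 l / 2) := by
      funext ⟨σ, y⟩
      exact hE σ y
    have hEd : Differentiable ℝ E := by
      rw [hE']
      refine Differentiable.const_add _ (Differentiable.mul (hP.comp ?_) ?_) <;> fun_prop
    rw [hu']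
    exact (hEd (τ, x)).inv hE0
  have hsum : ∑ i : Fin m, fderiv ℝ u (τ, x) (Pi.single i 1, 0) =
      fderiv ℝ u (τ, x) (1, 0) := by
    rw [← map_sum]
    congr 1
    ext i
    · simp [Prod.fst_sum, Finset.sum_apply, Pi.single_apply]
    · simp [Prod.snd_sum]
  have htime : ∀ s : ℝ, u ((τ, x) + s • ((1 : Fin m → ℝ), (0 : ℝ))) =
      1 / (1 + p * Real.exp (-1 / 2 * s + (x / Real.sqrt 2 - τ l / 2))) := by
    intro s
    have harg : ((τ, x) + s • ((1 : Fin m → ℝ), (0 : ℝ))) = (τ + s • 1, x) := by simp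
    rw [harg, hu, hE]
    simp only [Pi.add_apply, Pi.smul_apply, Pi.one_apply, smul_eq_mul, mul_one,
      add_sub_add_right_eq_sub, hp]
    congr 4
    ring
  have hspace : (fun y => u (τ, y)) = fun y =>
      1 / (1 + p * Real.exp (1 / Real.sqrt 2 * y + -(τ l / 2))) := by
    funext y
    rw [hu, hE]
    congr 4
    ring
  have hxarg : 1 / Real.sqrt 2 * x + -(τ l / 2) = x / Real.sqrt 2 - τ l / 2 := by ring
  have ht0 : -1 / 2 * (0 : ℝ) + (x / Real.sqrt 2 - τ l / 2) = x / Real.sqrt 2 - τ l / 2 := by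
    ring
  have hne : 1 + p * Real.exp (x / Real.sqrt 2 - τ l / 2) ≠ 0 := hw ▸ hE0
  have ht := hasDerivAt_one_div_one_add_mul_exp p (-1 / 2) (x / Real.sqrt 2 - τ l / 2) 0
    (by rwa [ht0])
  have hx := iterate_two_deriv_one_div_one_add_mul_exp p (1 / Real.sqrt 2) (-(τ l / 2)) x
    (by rwa [hxarg])
  rw [ht0] at ht
  rw [hxarg] at hx
  have hline : fderiv ℝ u (τ, x) (1, 0) =
      -(-1 / 2 * (p * Real.exp (x / Real.sqrt 2 - τ l / 2))) /
        (1 + p * Real.exp (x / Real.sqrt 2 - τ l / 2)) ^ 2 := by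
    rw [← hdiff.lineDeriv_eq_fderiv, lineDeriv, funext htime]
    exact ht.deriv
  have hsq : (1 / Real.sqrt 2) ^ 2 = 1 / 2 := by
    rw [div_pow, Real.sq_sqrt (by norm_num)]
    norm_num
  rw [hsum, hline, hspace, hx, hsq, hu, hw]
  generalize p * Real.exp (x / Real.sqrt 2 - τ l / 2) = w at hne ⊢
  field_simp
  ring
end

section
/- Let C ∈ ℝ. On the open set of (τ, x) ∈ ℝ × ℝ where 1 + C·exp(x/√2 − τ/2) ≠ 0, the function u(τ, x) := 1 / (1 + C·exp(x/√2 − τ/2)) solves the Huxley equation ∂u/∂τ = ∂²u/∂x² − u³ + u². -/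
/-- `u(τ,x) := 1 / (1 + C·exp(x/√2 − τ/2))` solves the Huxley equation
`∂u/∂τ = u_xx − u³ + u²` wherever the denominator does not vanish. -/
theorem stmt_14 (C : ℝ)
    (u : ℝ × ℝ → ℝ)
    (hu : ∀ τ x : ℝ, u (τ, x) = 1 / (1 + C * Real.exp (x / Real.sqrt 2 - τ / 2))) :
    ∀ τ x : ℝ, 1 + C * Real.exp (x / Real.sqrt 2 - τ / 2) ≠ 0 →
      deriv (fun t => u (t, x)) τ =
        deriv^[2] (fun y => u (τ, y)) x - (u (τ, x)) ^ 3 + (u (τ, x)) ^ 2 := by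
  intro τ x hx
  simp only [hu, Function.iterate_succ, Function.iterate_zero, Function.comp_apply, id_eq]
  set s := Real.sqrt 2
  have hs2 : s ^ 2 = 2 := Real.sq_sqrt (by norm_num)
  have hs0 : s ≠ 0 := by positivity
  have hEτ : HasDerivAt (fun t => 1 + C * Real.exp (x / s - t / 2))
      (C * (Real.exp (x / s - τ / 2) * (-(1 / 2)))) τ :=
    ((((hasDerivAt_id τ).div_const 2).const_sub (x / s)).exp.const_mul C).const_add 1
  have hEx (y : ℝ) : HasDerivAt (fun y => 1 + C * Real.exp (y / s - τ / 2))
      (C * (Real.exp (y / s - τ / 2) * (1 / s))) y :=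
    ((((hasDerivAt_id y).div_const s).sub_const (τ / 2)).exp.const_mul C).const_add 1
  have hux : deriv (fun y => 1 / (1 + C * Real.exp (y / s - τ / 2))) =ᶠ[nhds x]
      fun y => -(C * (Real.exp (y / s - τ / 2) * (1 / s))) /
        (1 + C * Real.exp (y / s - τ / 2)) ^ 2 := by
    filter_upwards [(hEx x).continuousAt.eventually_ne hx] with y hy
    simpa only [one_div, Pi.inv_def] using ((hEx y).inv hy).deriv
  have hnum : HasDerivAt (fun y => -(C * (Real.exp (y / s - τ / 2) * (1 / s))))
      (-(C * (Real.exp (x / s - τ / 2) * (1 / s) * (1 / s)))) x :=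
    (((((hasDerivAt_id x).div_const s).sub_const (τ / 2)).exp.mul_const (1 / s)).const_mul C).neg
  have huτ : deriv (fun t => 1 / (1 + C * Real.exp (x / s - t / 2))) τ =
      -(C * (Real.exp (x / s - τ / 2) * (-(1 / 2)))) /
        (1 + C * Real.exp (x / s - τ / 2)) ^ 2 := by
    simpa only [one_div, Pi.inv_def] using (hEτ.inv hx).deriv
  have huxx := (hnum.fun_div ((hEx x).fun_pow 2) (pow_ne_zero 2 hx)).deriv
  rw [huτ, hux.deriv_eq, huxx]
  generalize Real.exp (x / s - τ / 2) = e at hx ⊢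
  have hss : 1 / s * (1 / s) = 1 / 2 := by rw [← hs2]; field_simp
  generalize 1 / s = r at hss ⊢
  have hr : r ^ 2 = 1 / 2 := by rw [sq, hss]
  field_simp
  ring_nf
  simp only [hr]
  ring
end

section
/- Let n ≥ 1, μ ≠ 0 be a real constant, f : ℝⁿ → ℝ, and h¹, h² : ℝ² → ℝ. Let H¹, H² : ℝ² → ℝ be differentiable functions satisfying h¹(t)·∂Hʲ/∂t¹ + h²(t)·∂Hʲ/∂t² = 1 for j = 1, 2 and all t ∈ ℝ². Suppose v : ℝ² × ℝ → ℝ is smooth and solves the two-time canonical equation ∂v/∂τ¹ + ∂v/∂τ² = μ ∂ⁿv/∂xⁿ + f(v, ∂v/∂x, …, ∂^{n−1}v/∂x^{n−1}). Then u(t¹, t², x) := v(H¹(t¹,t²), H²(t¹,t²), x) solves h¹(t)·∂u/∂t¹ + h²(t)·∂u/∂t² = μ ∂ⁿu/∂xⁿ + f(u, ∂u/∂x, …, ∂^{n−1}u/∂x^{n−1}) at every point of ℝ² × ℝ. -/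
/-- Chain rule for `(t, x) ↦ v (H₁ t, H₂ t, x)` in a direction that leaves `x` fixed. -/
theorem fderiv_comp_times_apply {H₁ H₂ : ℝ × ℝ → ℝ} {v : ℝ × ℝ × ℝ → ℝ}
    (hH₁ : Differentiable ℝ H₁) (hH₂ : Differentiable ℝ H₂) (hv : Differentiable ℝ v)
    (t₁ t₂ x a b : ℝ) :
    fderiv ℝ (fun p : ℝ × ℝ × ℝ => v (H₁ (p.1, p.2.1), H₂ (p.1, p.2.1), p.2.2))
        (t₁, t₂, x) (a, b, 0) =
      fderiv ℝ H₁ (t₁, t₂) (a, b) *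
          fderiv ℝ v (H₁ (t₁, t₂), H₂ (t₁, t₂), x) (1, 0, 0) +
        fderiv ℝ H₂ (t₁, t₂) (a, b) *
          fderiv ℝ v (H₁ (t₁, t₂), H₂ (t₁, t₂), x) (0, 1, 0) := by
  let p : ℝ × ℝ × ℝ := (t₁, t₂, x)
  have hfst : HasFDerivAt (fun p : ℝ × ℝ × ℝ => p.1) (.fst ℝ ℝ (ℝ × ℝ)) p := hasFDerivAt_fst
  have hsnd : HasFDerivAt (fun p : ℝ × ℝ × ℝ => p.2) (.snd ℝ ℝ (ℝ × ℝ)) p := hasFDerivAt_snd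
  have htimes := hfst.prodMk hsnd.fst
  have hK₁ := HasFDerivAt.comp p (hH₁ (t₁, t₂)).hasFDerivAt htimes
  have hK₂ := HasFDerivAt.comp p (hH₂ (t₁, t₂)).hasFDerivAt htimes
  have hu := HasFDerivAt.comp p (hv (H₁ (t₁, t₂), H₂ (t₁, t₂), x)).hasFDerivAt
    (hK₁.prodMk (hK₂.prodMk hsnd.snd))
  have hsplit : ∀ c d : ℝ, ((c, d, 0) : ℝ × ℝ × ℝ) = c • (1, 0, 0) + d • (0, 1, 0) := by
    intro c d
    simp
  calc
    _ = fderiv ℝ v (H₁ (t₁, t₂), H₂ (t₁, t₂), x)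
          (fderiv ℝ H₁ (t₁, t₂) (a, b), fderiv ℝ H₂ (t₁, t₂) (a, b), 0) :=
      DFunLike.congr_fun hu.fderiv (a, b, 0)
    _ = _ := by rw [hsplit, map_add, map_smul, map_smul, smul_eq_mul, smul_eq_mul]

/-- if `H¹, H²` satisfy `h¹ ∂Hʲ/∂t¹ + h² ∂Hʲ/∂t² = 1` and `v` solves the
two-time canonical equation, then `u(t¹,t²,x) := v(H¹(t¹,t²), H²(t¹,t²), x)` solves
`h¹ ∂u/∂t¹ + h² ∂u/∂t² = μ ∂ⁿu/∂xⁿ + f(u, …, ∂^{n−1}u/∂x^{n−1})`. -/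
theorem stmt_18 (n : ℕ) (hn : 1 ≤ n) (μ : ℝ) (hμ : μ ≠ 0)
    (f : (Fin n → ℝ) → ℝ)
    (h₁ h₂ : ℝ × ℝ → ℝ)
    (H₁ H₂ : ℝ × ℝ → ℝ) (hH₁ : Differentiable ℝ H₁) (hH₂ : Differentiable ℝ H₂)
    (hH₁eq : ∀ t : ℝ × ℝ, h₁ t * fderiv ℝ H₁ t (1, 0) + h₂ t * fderiv ℝ H₁ t (0, 1) = 1)
    (hH₂eq : ∀ t : ℝ × ℝ, h₁ t * fderiv ℝ H₂ t (1, 0) + h₂ t * fderiv ℝ H₂ t (0, 1) = 1)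
    (v : ℝ × ℝ × ℝ → ℝ) (hv : ContDiff ℝ (⊤ : ℕ∞) v)
    (hveq : ∀ τ₁ τ₂ x : ℝ,
      fderiv ℝ v (τ₁, τ₂, x) (1, 0, 0) + fderiv ℝ v (τ₁, τ₂, x) (0, 1, 0) =
        μ * deriv^[n] (fun y => v (τ₁, τ₂, y)) x +
          f (fun j => deriv^[(j : ℕ)] (fun y => v (τ₁, τ₂, y)) x))
    (u : ℝ × ℝ × ℝ → ℝ)
    (hu : ∀ t₁ t₂ x : ℝ, u (t₁, t₂, x) = v (H₁ (t₁, t₂), H₂ (t₁, t₂), x)) :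
    ∀ t₁ t₂ x : ℝ,
      h₁ (t₁, t₂) * fderiv ℝ u (t₁, t₂, x) (1, 0, 0) +
        h₂ (t₁, t₂) * fderiv ℝ u (t₁, t₂, x) (0, 1, 0) =
          μ * deriv^[n] (fun y => u (t₁, t₂, y)) x +
            f (fun j => deriv^[(j : ℕ)] (fun y => u (t₁, t₂, y)) x) := by
  intro t₁ t₂ x
  have hu' : u = fun p => v (H₁ (p.1, p.2.1), H₂ (p.1, p.2.1), p.2.2) :=
    funext fun p => hu p.1 p.2.1 p.2.2
  have hv' : Differentiable ℝ v := hv.differentiable (by simp)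
  simp only [hu]
  rw [← hveq, hu', fderiv_comp_times_apply hH₁ hH₂ hv', fderiv_comp_times_apply hH₁ hH₂ hv']
  linear_combination
    fderiv ℝ v (H₁ (t₁, t₂), H₂ (t₁, t₂), x) (1, 0, 0) * hH₁eq (t₁, t₂) +
      fderiv ℝ v (H₁ (t₁, t₂), H₂ (t₁, t₂), x) (0, 1, 0) * hH₂eq (t₁, t₂)
end
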